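/- For k ∈ {1,…,N−2} set k̂ := min{k, N−1−k}. (i) If x ∈ [kR, kR+ρ/2], then for any r with kR+ρ−x ≤ r ≤ max{x, 1−x} one has μ(B(x,r))/(2r)^s ≤ max{ ρ^s/(2^s (kR+ρ−x)^s), (1+2k̂)ρ^s/(2^s (k̂R + (kR+ρ−x))^s), 1/(2^s (max{x,1−x})^s) }, and the bound is attained for some admissible r. (ii) If x ∈ [kR+ρ/2, kR+ρ], then for any r with x−kR ≤ r ≤ max{x, 1−x} one has μ(B(x,r))/(2r)^s ≤ max{ ρ^s/(2^s (x−kR)^s), (1+2k̂)ρ^s/(2^s (k̂R + (x−kR))^s), 1/(2^s (max{x,1−x})^s) }, and the bound is attained for some admissible r. -/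

import Mathlib

open MeasureTheory Filter Set Topology ENNReal

namespace HomogeneousCantorDensity

noncomputable def R (N : ℕ) (ρ : ℝ) : ℝ := (1 - ρ) / ((N : ℝ) - 1)

noncomputable def f (N : ℕ) (ρ : ℝ) (i : ℕ) (x : ℝ) : ℝ := ρ * x + (i : ℝ) * R N ρ

noncomputable def piMap (N : ℕ) (ρ : ℝ) (d : ℕ → ℕ) : ℝ :=
  R N ρ * ∑' i : ℕ, (d i : ℝ) * ρ ^ i

def cantorE (N : ℕ) (ρ : ℝ) : Set ℝ :=
  {x | ∃ d : ℕ → ℕ, (∀ i, d i < N) ∧ x = piMap N ρ d}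

/-- `μ = ∑_{i=0}^{N-1} (1/N) μ ∘ f_i⁻¹`. -/
def IsSelfSimilar (N : ℕ) (ρ : ℝ) (μ : Measure ℝ) : Prop :=
  μ = ∑ i ∈ Finset.range N, (N : ℝ≥0∞)⁻¹ • μ.map (f N ρ i)

/-- `T^n x` for `x = piMap N ρ d`. -/
noncomputable def Tn (N : ℕ) (ρ : ℝ) (d : ℕ → ℕ) (n : ℕ) : ℝ :=
  piMap N ρ (fun i => d (n + i))

/-- pointwise lower `s`-density of `μ` at `x`. -/
noncomputable def lowerDensity (μ : Measure ℝ) (s x : ℝ) : ℝ :=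
  liminf (fun r : ℝ => (μ (Ioo (x - r) (x + r))).toReal / (2 * r) ^ s) (𝓝[>] 0)

/-- pointwise upper `s`-density of `μ` at `x`. -/
noncomputable def upperDensity (μ : Measure ℝ) (s x : ℝ) : ℝ :=
  limsup (fun r : ℝ => (μ (Ioo (x - r) (x + r))).toReal / (2 * r) ^ s) (𝓝[>] 0)

/-- Parameters: `G` is the translation step. -/
structure Par (N : ℕ) (ρ G : ℝ) : Prop where
  hN : 3 ≤ N
  hρ : 0 < ρ
  hNρ : (N : ℝ) ^ 2 * ρ ≤ 1
  hG : ((N : ℝ) - 1) * G + ρ = 1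

/-- Distribution functions of self-similar measures. -/
structure IsCdf (N : ℕ) (ρ G : ℝ) (F : ℝ → ℝ) : Prop where
  mono : Monotone F
  zero : ∀ y, y ≤ 0 → F y = 0
  one : ∀ y, 1 ≤ y → F y = 1
  eq : ∀ y, (N : ℝ) * F y = ∑ i ∈ Finset.range N, F ((y - (i : ℝ) * G) / ρ)

section
variable {N : ℕ} {ρ G : ℝ} {F : ℝ → ℝ}

theorem Par.three (h : Par N ρ G) : (3 : ℝ) ≤ N := by exact_mod_cast h.hN

theorem Par.G4 (h : Par N ρ G) : 4 * ρ ≤ G := by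
  have h3 := h.three
  have h1 := h.hNρ
  have h2 := h.hG
  have h0 := h.hρ
  by_contra hc
  push Not at hc
  nlinarith [mul_nonneg (mul_nonneg (sub_nonneg.2 h3) (by linarith : (0:ℝ) ≤ N - 1)) h0.le]

theorem Par.Gpos (h : Par N ρ G) : 0 < G := by linarith [h.G4, h.hρ]

theorem Par.Nρ (h : Par N ρ G) : (N : ℝ) * ρ ≤ 1 / 3 := by
  have h3 := h.three
  have h1 := h.hNρ
  have h0 := h.hρ
  nlinarith [mul_nonneg (mul_nonneg (sub_nonneg.2 h3) (by linarith : (0:ℝ) ≤ N)) h0.le]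

theorem IsCdf.nonneg (hF : IsCdf N ρ G F) (y : ℝ) : 0 ≤ F y := by
  rw [← hF.zero (min y 0) (min_le_right _ _)]
  exact hF.mono (min_le_left _ _)

theorem IsCdf.le_one (hF : IsCdf N ρ G F) (y : ℝ) : F y ≤ 1 := by
  rw [← hF.one (max y 1) (le_max_right _ _)]
  exact hF.mono (le_max_left _ _)

theorem IsCdf.ub (h : Par N ρ G) (hF : IsCdf N ρ G F) (j : ℕ) (y : ℝ)
    (hy : y ≤ j * G) : (N : ℝ) * F y ≤ j := by
  rw [hF.eq]
  have : ∀ i ∈ Finset.range N, F ((y - (i : ℝ) * G) / ρ) ≤ if i < j then 1 else 0 := by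
    intro i _
    split_ifs with hi
    · exact hF.le_one _
    · refine (hF.zero _ ?_).le
      have : (j : ℝ) ≤ i := by exact_mod_cast not_lt.1 hi
      apply div_nonpos_of_nonpos_of_nonneg _ h.hρ.le
      nlinarith [h.Gpos]
  refine (Finset.sum_le_sum this).trans ?_
  rw [← Finset.sum_filter, Finset.sum_const, nsmul_eq_mul, mul_one]
  norm_cast
  calc _ ≤ (Finset.range j).card := Finset.card_le_card (by intro i; simp)
    _ = j := by simp

theorem IsCdf.lb (h : Par N ρ G) (hF : IsCdf N ρ G F) (j : ℕ) (hj : j ≤ N) (y : ℝ)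
    (hy : ((j : ℝ) - 1) * G + ρ ≤ y) : (j : ℝ) ≤ (N : ℝ) * F y := by
  rw [hF.eq]
  have : ∀ i ∈ Finset.range N, (if i < j then 1 else 0) ≤ F ((y - (i : ℝ) * G) / ρ) := by
    intro i _
    split_ifs with hi
    · refine (hF.one _ ?_).ge
      have : (i : ℝ) + 1 ≤ j := by exact_mod_cast hi
      rw [le_div_iff₀ h.hρ]
      nlinarith [h.Gpos]
    · exact hF.nonneg _
  refine le_trans ?_ (Finset.sum_le_sum this)
  rw [← Finset.sum_filter, Finset.sum_const, nsmul_eq_mul, mul_one]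
  norm_cast
  calc j = (Finset.range j).card := by simp
    _ ≤ _ := Finset.card_le_card (by intro i; simp; omega)

theorem IsCdf.piece (h : Par N ρ G) (hF : IsCdf N ρ G F) (j : ℕ) (hj : j < N) (y : ℝ)
    (hy : ((j : ℝ) - 1) * G + ρ ≤ y) (hy2 : y ≤ ((j : ℝ) + 1) * G) :
    (N : ℝ) * F y = j + F ((y - j * G) / ρ) := by
  rw [hF.eq]
  have : ∀ i ∈ Finset.range N, F ((y - (i : ℝ) * G) / ρ) = (if i < j then 1 else 0) +
      (if i = j then F ((y - j * G) / ρ) else 0) := by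
    intro i _
    rcases lt_trichotomy i j with hi | hi | hi
    · rw [if_pos hi, if_neg hi.ne, add_zero]
      apply hF.one
      have : (i : ℝ) + 1 ≤ j := by exact_mod_cast hi
      rw [le_div_iff₀ h.hρ]
      nlinarith [h.Gpos]
    · subst hi; simp
    · rw [if_neg (by omega), if_neg hi.ne', add_zero]
      apply hF.zero
      have : (j : ℝ) + 1 ≤ i := by exact_mod_cast hi
      apply div_nonpos_of_nonpos_of_nonneg _ h.hρ.le
      nlinarith [h.Gpos]
  rw [Finset.sum_congr rfl this, Finset.sum_add_distrib, Finset.sum_ite_eq', if_pos (by simpa),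
    ← Finset.sum_filter, Finset.sum_const, nsmul_eq_mul, mul_one]
  congr 2
  have : (Finset.range N).filter (· < j) = Finset.range j := by
    ext i; simp; omega
  rw [this]; simp

theorem tiny {a b c : ℝ} (M : ℝ) (hM : 3 ≤ M) (h : ∀ n : ℕ, a ≤ b + c * (1 / M) ^ n) : a ≤ b := by
  have : Tendsto (fun n : ℕ => b + c * (1 / M) ^ n) atTop (𝓝 (b + c * 0)) := by
    refine Tendsto.const_add _ (Tendsto.const_mul _ ?_)
    apply _root_.tendsto_pow_atTop_nhds_zero_of_lt_one (by positivity)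
    rw [div_lt_one (by linarith)]; linarith
  rw [mul_zero, add_zero] at this
  exact ge_of_tendsto' this h

/-- index of `z` -/
theorem idx (h : Par N ρ G) (z : ℝ) (h0 : 0 ≤ z) : ∃ j : ℕ, j * G ≤ z ∧ z < (j + 1) * G := by
  refine ⟨⌊z / G⌋₊, ?_, ?_⟩
  · rw [← le_div_iff₀ h.Gpos]; exact Nat.floor_le (div_nonneg h0 h.Gpos.le)
  · rw [← div_lt_iff₀ h.Gpos]; exact Nat.lt_floor_add_one _

theorem scale (h : Par N ρ G) (z : ℝ) (h0 : 0 ≤ z) : N * (z / G) ≤ z / ρ / (N * G) := by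
  have h3 := h.three
  have hG := h.Gpos
  have hρ := h.hρ
  rw [div_div, le_div_iff₀ (by positivity)]
  have : N * (z / G) * (ρ * (N * G)) = N ^ 2 * ρ * z := by field_simp
  rw [this]
  nlinarith [h.hNρ]

theorem IsCdf.low (h : Par N ρ G) (hF : IsCdf N ρ G F) (z : ℝ) (h0 : 0 ≤ z) (h1 : z ≤ 1) :
    z / (N * G) ≤ F z := by
  have h3 := h.three
  have hG := h.Gpos
  have hρ := h.hρ
  have key : ∀ n : ℕ, ∀ z : ℝ, 0 ≤ z → z ≤ 1 → z / (N * G) ≤ F z + 1 / (N * G) * (1 / N) ^ n := by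
    intro n
    induction n with
    | zero =>
      intro z h0 h1
      have : z / (N * G) ≤ 1 / (N * G) := by gcongr
      have := hF.nonneg z
      simp only [pow_zero, mul_one]; linarith
    | succ n ih =>
      intro z h0 h1
      obtain ⟨j, hj1, hj2⟩ := idx h z h0
      have hjN : j < N := by
        by_contra hc
        have : (N : ℝ) ≤ j := by exact_mod_cast not_lt.1 hc
        have := h.hG
        nlinarith [h.G4]
      have hp := hF.piece h j hjN z (by linarith [h.G4]) hj2.le
      have hpos : 0 ≤ 1 / (N * G) * (1 / (N : ℝ)) ^ n := by positivity
      have hz : (N : ℝ) * (z / (N * G)) = j + (z - j * G) / G := by field_simp; ring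
      have main : (N : ℝ) * (z / (N * G)) ≤ N * F z + 1 / (N * G) * (1 / N) ^ n := by
        rw [hp, hz]
        by_cases hc : z - j * G ≤ ρ
        · have := ih ((z - j * G) / ρ) (div_nonneg (by linarith) hρ.le) (by rwa [div_le_one hρ])
          have h5 := scale h (z - j * G) (by linarith)
          have h6 : 0 ≤ (z - j * G) / G := div_nonneg (by linarith) hG.le
          nlinarith
        · rw [hF.one _ (by rw [le_div_iff₀ hρ]; linarith)]
          have : (z - j * G) / G ≤ 1 := by rw [div_le_one hG]; linarith
          linarith
      have e : (N : ℝ) * (F z + 1 / (N * G) * (1 / N) ^ (n + 1)) = 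
        N * F z + 1 / (N * G) * (1 / N) ^ n := by rw [pow_succ]; field_simp
      rw [← e] at main
      exact le_of_mul_le_mul_left main (by linarith)
  exact tiny N h3 (fun n => key n z h0 h1)

theorem IsCdf.high (h : Par N ρ G) (hF : IsCdf N ρ G F) (z : ℝ) (h0 : 0 ≤ z) (h1 : z ≤ 1) :
    F z ≤ 1 - (1 - z) / (N * G) := by
  have h3 := h.three
  have hG := h.Gpos
  have hρ := h.hρ
  have key : ∀ n : ℕ, ∀ z : ℝ, 0 ≤ z → z ≤ 1 →
      F z ≤ 1 - (1 - z) / (N * G) + 1 / (N * G) * (1 / N) ^ n := by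
    intro n
    induction n with
    | zero =>
      intro z h0 h1
      have : (1 - z) / (N * G) ≤ 1 / (N * G) := by gcongr; linarith
      have := hF.le_one z
      simp only [pow_zero, mul_one]; linarith
    | succ n ih =>
      intro z h0 h1
      -- apply `idx` to `1 - z`, then reflect
      obtain ⟨i, hi1, hi2⟩ := idx h (1 - z) (by linarith)
      have hiN : i < N := by
        by_contra hc
        have : (N : ℝ) ≤ i := by exact_mod_cast not_lt.1 hc
        have := h.hG
        nlinarith [h.G4]
      obtain ⟨j, rfl⟩ : ∃ j, N = i + j + 1 := ⟨N - 1 - i, by omega⟩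
      have hg := h.hG
      set M : ℕ := i + j + 1 with hM
      have hMr : (M : ℝ) = i + j + 1 := by rw [hM]; push_cast; ring
      have hg' : (i : ℝ) * G + j * G + ρ = 1 := by rw [hMr] at hg; linarith
      have hp := hF.piece h j (by omega) z (by linarith) (by linarith [h.G4])
      have hpos : 0 ≤ 1 / (M * G) * (1 / (M : ℝ)) ^ n := by positivity
      have hz : (M : ℝ) * (1 - (1 - z) / (M * G)) = j + 1 - (j * G + ρ - z) / G := by
        have : 1 - z = i * G + (j * G + ρ - z) := by linarith
        rw [this, mul_sub, mul_one]
        have : (M : ℝ) * ((i * G + (j * G + ρ - z)) / (M * G)) = i + (j * G + ρ - z) / G := by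
          field_simp
        rw [this]; linarith
      have main : M * F z ≤ (M : ℝ) * (1 - (1 - z) / (M * G)) + 1 / (M * G) * (1 / M) ^ n := by
        rw [hp, hz]
        by_cases hc : 0 ≤ z - j * G
        · have := ih ((z - j * G) / ρ) (div_nonneg (by linarith) hρ.le)
            (by rw [div_le_one hρ]; linarith)
          have h5 := scale h (j * G + ρ - z) (by linarith)
          have h6 : 0 ≤ (j * G + ρ - z) / G := div_nonneg (by linarith) hG.le
          have e : 1 - (z - j * G) / ρ = (j * G + ρ - z) / ρ := by field_simp; ring
          rw [e] at this
          nlinarith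
        · rw [hF.zero _ (div_nonpos_of_nonpos_of_nonneg (by linarith) hρ.le)]
          have : (j * G + ρ - z) / G ≤ 1 := by rw [div_le_one hG]; linarith
          linarith
      have e : (M : ℝ) * (1 - (1 - z) / (M * G) + 1 / (M * G) * (1 / M) ^ (n + 1)) = 
        (M : ℝ) * (1 - (1 - z) / (M * G)) + 1 / (M * G) * (1 / M) ^ n := by
        rw [pow_succ, mul_add]; field_simp
      rw [← e] at main
      exact le_of_mul_le_mul_left main (by linarith)
  exact tiny N h3 (fun n => key n z h0 h1)

theorem concave_affine {s C α β p q r : ℝ} (hs0 : 0 ≤ s) (hs1 : s ≤ 1) (hC : 0 ≤ C) (hp : 0 ≤ p)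
    (hpr : p ≤ r) (hrq : r ≤ q) (h1 : α + β * p ≤ C * p ^ s) (h2 : α + β * q ≤ C * q ^ s) :
    α + β * r ≤ C * r ^ s := by
  rcases eq_or_lt_of_le (hpr.trans hrq) with he | hlt
  · have : r = p := by linarith
    rwa [this]
  have a1 : 0 ≤ (q - r) / (q - p) := div_nonneg (by linarith) (by linarith)
  have a2 : 0 ≤ (r - p) / (q - p) := div_nonneg (by linarith) (by linarith)
  have hc := (Real.concaveOn_rpow hs0 hs1).2 (show p ∈ Ici (0 : ℝ) from hp)
    (show q ∈ Ici (0 : ℝ) from hp.trans hlt.le) a1 a2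
    (by rw [← add_div, div_eq_one_iff_eq (by linarith)]; ring)
  have hne : q - p ≠ 0 := by linarith
  simp only [smul_eq_mul] at hc
  have e : (q - r) / (q - p) * p + (r - p) / (q - p) * q = r := by field_simp; ring
  rw [e] at hc
  have e2 : α + β * r = (q - r) / (q - p) * (α + β * p) + (r - p) / (q - p) * (α + β * q) := by
    field_simp; ring
  rw [e2]
  nlinarith [mul_le_mul_of_nonneg_left h1 a1, mul_le_mul_of_nonneg_left h2 a2,
    mul_le_mul_of_nonneg_left hc hC]


theorem sqrt_mono {s a x r : ℝ} (hs0 : 0 ≤ s) (hs : s ≤ 1 / 2) (ha : 0 ≤ a) (har : a ≤ r)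
    (hr : 0 < r) (hrx : r ≤ x) : a + r ≤ (a + x) * (r / x) ^ s := by
  have hx : 0 < x := by linarith
  have h1 : (r / x) ^ (1 / 2 : ℝ) ≤ (r / x) ^ s :=
    Real.rpow_le_rpow_of_exponent_ge (by positivity) ((div_le_one hx).2 hrx) hs
  rw [← Real.sqrt_eq_rpow] at h1
  refine le_trans ?_ (mul_le_mul_of_nonneg_left h1 (by linarith))
  apply le_of_sq_le_sq _ (by positivity)
  rw [mul_pow, Real.sq_sqrt (by positivity), mul_div_assoc', le_div_iff₀ hx]
  have : a ^ 2 ≤ x * r := by nlinarith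
  nlinarith [mul_nonneg (sub_nonneg.2 this) (sub_nonneg.2 hrx)]

/-- stage one -/
theorem stage1 (h : Par N ρ G) (hF : IsCdf N ρ G F) (k K : ℕ) (hk : K ≤ k) (hk' : k + K + 1 ≤ N)
    (x t r : ℝ) (hx : x = k * G + ρ - t) (ht1 : ρ / 2 ≤ t) (ht2 : t ≤ ρ) (hr1 : t ≤ r)
    (hr2 : r ≤ K * G + t) :
    N * (F (x + r) - F (x - r)) ≤ 1 + 2 * ((r - t) / G) := by
  have h3 := h.three
  have hG := h.Gpos
  have hG4 := h.G4
  have hρ := h.hρ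
  obtain ⟨n, hn1, hn2⟩ := idx h (r - t) (by linarith)
  obtain ⟨v, hv⟩ : ∃ v, v = r - t - n * G := ⟨_, rfl⟩
  have hr : r = t + n * G + v := by linarith
  have hv0 : 0 ≤ v := by linarith
  have hvG : v < G := by linarith
  have hnK : n ≤ K := by
    have : (n : ℝ) * G ≤ K * G := by linarith
    exact_mod_cast le_of_mul_le_mul_right this hG
  obtain ⟨p, rfl⟩ : ∃ p, k = n + p := ⟨k - n, by omega⟩
  have hrhs : (r - t) / G = n + v / G := by rw [hr]; field_simp; ring
  rw [hrhs, mul_sub]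
  push_cast at hx
  by_cases hc : v ≤ G - ρ
  · have u1 := hF.ub h (n + p + n + 1) (x + r) (by push_cast; rw [hx, hr]; linarith)
    push_cast at u1
    by_cases hc2 : v + (2 * t - ρ) ≤ G - ρ
    · have l1 := hF.lb h p (by omega) (x - r) (by rw [hx, hr]; linarith)
      have : 0 ≤ v / G := by positivity
      linarith
    · have l1 : (p : ℝ) - 1 ≤ N * F (x - r) := by
        rcases p with _ | p
        · have := mul_nonneg (by linarith : (0 : ℝ) ≤ N) (hF.nonneg (x - r))
          push_cast; linarith
        · have := hF.lb h p (by omega) (x - r) (by rw [hx, hr]; push_cast; linarith)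
          push_cast; linarith
      have : 1 / 2 ≤ v / G := by rw [le_div_iff₀ hG]; linarith
      linarith
  · have hnK' : n < K := by
      have : (n : ℝ) * G < K * G := by linarith
      exact_mod_cast lt_of_mul_lt_mul_right this hG.le
    have l1 : (p : ℝ) - 1 ≤ N * F (x - r) := by
      rcases p with _ | p
      · omega
      · have := hF.lb h p (by omega) (x - r) (by rw [hx, hr]; push_cast; linarith)
        push_cast; linarith
    have u1 := hF.piece h (n + p + n + 1) (by omega) (x + r)
      (by push_cast; rw [hx, hr]; linarith) (by push_cast; rw [hx, hr]; linarith)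
    have e : x + r - ((n + p + n + 1 : ℕ) : ℝ) * G = v + ρ - G := by
      push_cast; rw [hx, hr]; ring
    rw [e] at u1
    have u2 := hF.high h ((v + ρ - G) / ρ) (div_nonneg (by linarith) hρ.le)
      (by rw [div_le_one hρ]; linarith)
    have e2 : 1 - (v + ρ - G) / ρ = (G - v) / ρ := by field_simp; ring
    rw [e2] at u2
    have u3 := scale h (G - v) (by linarith)
    have e3 : (G - v) / G = 1 - v / G := by field_simp
    have : 0 ≤ 1 - v / G := by rw [← e3]; exact div_nonneg (by linarith) hG.le
    rw [e3] at u3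
    push_cast at u1
    nlinarith

set_option maxHeartbeats 4000000 in
/-- The two-sided bound. -/
theorem core (h : Par N ρ G) (hF : IsCdf N ρ G F) (s : ℝ) (hs0 : 0 ≤ s) (hs : s ≤ 1 / 2)
    (k : ℕ) (hk1 : 1 ≤ k) (hk2 : k + 2 ≤ N)
    (x t r C : ℝ) (hx : x = k * G + ρ - t) (ht1 : ρ / 2 ≤ t) (ht2 : t ≤ ρ) (hr1 : t ≤ r)
    (hr2 : r ≤ max x (1 - x)) (hC : 0 ≤ C) (hC1 : 1 ≤ C * t ^ s)
    (hC2 : 1 + 2 * ((min k (N - 1 - k) : ℕ) : ℝ) ≤ C * (((min k (N - 1 - k) : ℕ) : ℝ) * G + t) ^ s)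
    (hC3 : (N : ℝ) ≤ C * (max x (1 - x)) ^ s) :
    N * (F (x + r) - F (x - r)) ≤ C * r ^ s := by
  have h3 := h.three
  have hG := h.Gpos
  have hG4 := h.G4
  have hρ := h.hρ
  have htpos : 0 < t := by linarith
  by_cases hst : r ≤ ((min k (N - 1 - k) : ℕ) : ℝ) * G + t
  · have := stage1 h hF k (min k (N - 1 - k)) (min_le_left _ _) (by omega) x t r hx ht1 ht2 hr1 hst
    refine this.trans ?_
    have := concave_affine (s := s) (C := C) (α := 1 - 2 * t / G) (β := 2 / G) (p := t)
      (q := ((min k (N - 1 - k) : ℕ) : ℝ) * G + t) (r := r) hs0 (by linarith) hC htpos.le hr1 hst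
      (by refine le_trans (le_of_eq ?_) hC1; field_simp; ring)
      (by refine le_trans (le_of_eq ?_) hC2; field_simp; ring)
    refine le_trans (le_of_eq ?_) this
    field_simp; ring
  push Not at hst
  obtain ⟨q, rfl⟩ : ∃ q, N = k + q + 1 := ⟨N - 1 - k, by omega⟩
  have hq : k + q + 1 - 1 - k = q := by omega
  rw [hq] at hst hC2
  have hg := h.hG
  set M : ℕ := k + q + 1 with hM
  have hMr : (M : ℝ) = k + q + 1 := by rw [hM]; push_cast; ring
  have hg' : (k : ℝ) * G + q * G + ρ = 1 := by rw [hMr] at hg; linarith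
  have hk1r : (1 : ℝ) ≤ k := by exact_mod_cast hk1
  have h1x : 1 - x = q * G + t := by rw [hx]; linarith
  rcases le_or_gt k q with hkq | hkq
  · rw [min_eq_left hkq] at hst hC2
    have hkqr : (k : ℝ) ≤ q := by exact_mod_cast hkq
    have hmax : max x (1 - x) = 1 - x := by
      apply max_eq_right; rw [h1x, hx]; nlinarith
    rw [hmax] at hr2 hC3
    have u := hF.high h (x + r) (by nlinarith) (by linarith)
    have l := hF.nonneg (x - r)
    have u2 : (M : ℝ) * (F (x + r) - F (x - r)) ≤ M - (1 - (x + r)) / G := by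
      have : (M : ℝ) - (1 - (x + r)) / G = M * (1 - (1 - (x + r)) / (M * G)) := by field_simp
      rw [this]
      apply mul_le_mul_of_nonneg_left _ (by linarith)
      linarith
    refine u2.trans ?_
    have := concave_affine (s := s) (C := C) (α := M - (1 - x) / G) (β := 1 / G) (p := k * G + t)
      (q := 1 - x) (r := r) hs0 (by linarith) hC (by positivity) hst.le hr2
      (by refine le_trans (le_of_eq ?_) hC2; rw [h1x, hMr]; field_simp; ring)
      (by refine le_trans (le_of_eq ?_) hC3; ring)
    refine le_trans (le_of_eq ?_) this
    field_simp; ring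
  · rw [min_eq_right hkq.le] at hst hC2
    obtain ⟨m, rfl⟩ : ∃ m, k = q + m + 1 := ⟨k - q - 1, by omega⟩
    push_cast at *
    have hq0 : (0 : ℝ) ≤ q := Nat.cast_nonneg q
    have hm0 : (0 : ℝ) ≤ m := Nat.cast_nonneg m
    have hqG : 0 ≤ q * G := by positivity
    have hmG : 0 ≤ m * G := by positivity
    have hmax : max x (1 - x) = x := by
      apply max_eq_left; rw [h1x, hx]; linarith
    rw [hmax] at hr2 hC3
    have hxpos : 0 < x := by linarith
    -- mass bound
    have u2 : (M : ℝ) * (F (x + r) - F (x - r)) ≤ M - M * F (x - r) := by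
      have := hF.le_one (x + r)
      nlinarith
    refine u2.trans ?_
    obtain ⟨r₁, hr₁⟩ : ∃ r₁, r₁ = (q + 1) * G + ρ - t := ⟨_, rfl⟩
    have hr₁x : r₁ ≤ x := by rw [hr₁, hx]; linarith
    have hr₁pos : 0 < r₁ := by rw [hr₁]; linarith
    -- lines of slope 1 / G
    have line : ∀ r', r₁ ≤ r' → r' ≤ x → M - (x - r') / G ≤ C * r' ^ s := by
      intro r' h1 h2
      have hr' : 0 < r' := by linarith
      have := sqrt_mono (a := (q + 1) * G - (ρ - t)) (x := x) (r := r') hs0 hs (by linarith)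
        (by linarith) hr' h2
      have e1 : M - (x - r') / G = ((q + 1) * G - (ρ - t) + r') / G := by
        rw [hMr, hx]; field_simp; ring
      have e2 : ((q + 1) * G - (ρ - t) + x) = M * G := by
        rw [hMr, hx]; ring
      rw [e1, div_le_iff₀ hG]
      refine this.trans ?_
      rw [e2, Real.div_rpow hr'.le hxpos.le]
      have hxs : 0 < x ^ s := Real.rpow_pos_of_pos hxpos s
      have hrs : 0 < r' ^ s := Real.rpow_pos_of_pos hr' s
      rw [mul_div_assoc', div_le_iff₀ hxs]
      nlinarith [mul_le_mul_of_nonneg_right hC3 (mul_pos hG hrs).le]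
    by_cases hA : r₁ ≤ r
    · have l := hF.low h (x - r) (by linarith) (by linarith)
      refine le_trans ?_ (line r hA hr2)
      have : (x - r) / G = M * ((x - r) / (M * G)) := by field_simp
      rw [this]
      have := mul_le_mul_of_nonneg_left l (by linarith : (0 : ℝ) ≤ M)
      linarith
    push Not at hA
    by_cases hB : r₁ - ρ ≤ r
    · have e : x - r - m * G = r₁ - r := by rw [hx, hr₁]; ring
      have hp := hF.piece h m (by omega) (x - r) (by linarith) (by linarith)
      rw [e] at hp
      have l := hF.low h ((r₁ - r) / ρ) (div_nonneg (by linarith) hρ.le)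
        (by rw [div_le_one hρ]; linarith)
      have l2 := scale h (r₁ - r) (by linarith)
      have l3 := line r₁ le_rfl hr₁x
      have e4 : M - (x - r₁) / G = 2 * q + 2 := by
        rw [hMr, hx, hr₁]; field_simp; ring
      rw [e4] at l3
      have hrpos : 0 < r := by linarith
      have step1 : M - M * F (x - r) ≤ (2 * q + 2) * (r / r₁) := by
        have : (2 * q + 2) * (r / r₁) = (2 * q + 2) - (2 * q + 2) * ((r₁ - r) / r₁) := by
          field_simp; ring
        rw [this, hp, hMr]
        have : (2 * q + 2) * ((r₁ - r) / r₁) ≤ M * ((r₁ - r) / G) := by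
          rw [mul_div_assoc', mul_div_assoc', div_le_div_iff₀ hr₁pos hG]
          have a1 : (2 * q + 2) * G ≤ M * r₁ := by
            have : (q + 1) * G ≤ r₁ := by linarith
            nlinarith
          nlinarith [mul_le_mul_of_nonneg_right a1 (by linarith : 0 ≤ r₁ - r)]
        linarith
      have step2 : r / r₁ ≤ (r / r₁) ^ s := by
        have := Real.rpow_le_rpow_of_exponent_ge (x := r / r₁) (y := 1) (z := s) (by positivity)
          ((div_le_one hr₁pos).2 hA.le) (by linarith)
        rwa [Real.rpow_one] at this
      refine step1.trans ((mul_le_mul_of_nonneg_left step2 (by linarith)).trans ?_)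
      rw [Real.div_rpow hrpos.le hr₁pos.le]
      have hxs : 0 < r₁ ^ s := Real.rpow_pos_of_pos hr₁pos s
      have hrs : 0 < r ^ s := Real.rpow_pos_of_pos hrpos s
      rw [mul_div_assoc', div_le_iff₀ hxs]
      nlinarith [mul_le_mul_of_nonneg_right l3 hrs.le]
    · push Not at hB
      have l := hF.lb h (m + 1) (by omega) (x - r) (by push_cast; linarith)
      push_cast at l
      have : (q * G + t) ^ s ≤ r ^ s := Real.rpow_le_rpow (by positivity) hst.le hs0
      have := mul_le_mul_of_nonneg_left this hC
      linarith

end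

section
variable {N : ℕ} {ρ : ℝ} {μ : Measure ℝ}

theorem par (hN : 3 ≤ N) (hρ0 : 0 < ρ) (hρ1 : ρ ≤ 1 / (N : ℝ) ^ 2) : Par N ρ (R N ρ) := by
  have h3 : (3 : ℝ) ≤ N := by exact_mod_cast hN
  refine ⟨hN, hρ0, ?_, ?_⟩
  · rw [le_div_iff₀ (by positivity)] at hρ1; linarith
  · unfold R
    have : (N : ℝ) - 1 ≠ 0 := by linarith
    field_simp; ring

theorem f_meas (i : ℕ) : Measurable (f N ρ i) := by unfold f; fun_prop

theorem ss_apply [IsProbabilityMeasure μ] (hN : 3 ≤ N) (hss : IsSelfSimilar N ρ μ) {A : Set ℝ}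
    (hA : MeasurableSet A) :
    (N : ℝ) * μ.real A = ∑ i ∈ Finset.range N, μ.real (f N ρ i ⁻¹' A) := by
  have h3 : (3 : ℝ) ≤ N := by exact_mod_cast hN
  have h1 : μ A = ∑ i ∈ Finset.range N, (N : ℝ≥0∞)⁻¹ * μ (f N ρ i ⁻¹' A) := by
    conv_lhs => rw [hss]
    rw [Measure.finsetSum_apply]
    refine Finset.sum_congr rfl fun i _ => ?_
    rw [Measure.smul_apply, Measure.map_apply (f_meas i) hA, smul_eq_mul]
  have h2 : μ.real A = ∑ i ∈ Finset.range N, (N : ℝ)⁻¹ * μ.real (f N ρ i ⁻¹' A) := by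
    unfold Measure.real
    rw [h1, ENNReal.toReal_sum]
    · refine Finset.sum_congr rfl fun i _ => ?_
      rw [ENNReal.toReal_mul, ENNReal.toReal_inv, ENNReal.toReal_natCast]
    · intro i _
      refine ENNReal.mul_ne_top ?_ (measure_ne_top _ _)
      rw [Ne, ENNReal.inv_eq_top]
      have : N ≠ 0 := by omega
      exact_mod_cast this
  rw [h2, ← Finset.mul_sum, ← mul_assoc, mul_inv_cancel₀ (by linarith), one_mul]

theorem ss_reflect (h : Par N ρ (R N ρ)) (hss : IsSelfSimilar N ρ μ) :
    IsSelfSimilar N ρ (μ.map (fun y => 1 - y)) := by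
  have hm : Measurable (fun y : ℝ => 1 - y) := by fun_prop
  unfold IsSelfSimilar
  ext A hA
  rw [Measure.map_apply hm hA]
  conv_lhs => rw [hss]
  rw [Measure.finsetSum_apply, Measure.finsetSum_apply, ← Finset.sum_range_reflect]
  refine Finset.sum_congr rfl fun i hi => ?_
  have hi : i < N := by simpa using hi
  rw [Measure.smul_apply, Measure.smul_apply, Measure.map_apply (f_meas _) (hm hA),
    Measure.map_apply (f_meas _) hA, Measure.map_apply hm ((f_meas _) hA)]
  congr 2
  ext y
  simp only [mem_preimage]
  have : 1 - f N ρ (N - 1 - i) y = f N ρ i (1 - y) := by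
    unfold f
    have hg := h.hG
    obtain ⟨j, rfl⟩ : ∃ j, N = i + j + 1 := ⟨N - 1 - i, by omega⟩
    have : i + j + 1 - 1 - i = j := by omega
    rw [this]
    set G := R (i + j + 1) ρ
    push_cast at hg
    linarith
  rw [this]

theorem ioi_one [IsProbabilityMeasure μ] (h : Par N ρ (R N ρ)) (hss : IsSelfSimilar N ρ μ) :
    μ (Ioi 1) = 0 := by
  have h3 := h.three
  have hG := h.Gpos
  have hρ := h.hρ
  have hg := h.hG
  have hρ1 : ρ < 1 := by nlinarith [h.Nρ]
  have step : ∀ d : ℝ, 0 < d → μ.real (Ioi (1 + d)) ≤ μ.real (Ioi (1 + d / ρ)) := by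
    intro d hd
    have e := ss_apply h.hN hss (A := Ioi (1 + d)) measurableSet_Ioi
    have : ∀ i ∈ Finset.range N, μ.real (f N ρ i ⁻¹' Ioi (1 + d)) ≤ μ.real (Ioi (1 + d / ρ)) := by
      intro i hi
      have hi : i + 1 ≤ N := by simpa using hi
      have hi' : (i : ℝ) + 1 ≤ N := by exact_mod_cast hi
      refine measureReal_mono ?_
      intro y hy
      simp only [mem_preimage, mem_Ioi, f] at hy ⊢
      have : (i : ℝ) * R N ρ ≤ (N - 1) * R N ρ := by gcongr; linarith
      have h5 : ρ + d < ρ * y := by linarith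
      have : ρ * (1 + d / ρ) < ρ * y := by
        have : ρ * (1 + d / ρ) = ρ + d := by field_simp
        linarith
      exact lt_of_mul_lt_mul_left this hρ.le
    have := Finset.sum_le_sum this
    rw [← e, Finset.sum_const, Finset.card_range, nsmul_eq_mul] at this
    exact le_of_mul_le_mul_left this (by linarith)
  have iter : ∀ d : ℝ, 0 < d → ∀ n : ℕ, μ.real (Ioi (1 + d)) ≤ μ.real (Ioi (1 + d / ρ ^ n)) := by
    intro d hd n
    induction n with
    | zero => simp
    | succ n ih =>
      refine ih.trans ((step _ (by positivity)).trans (le_of_eq ?_))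
      rw [pow_succ, div_div]
  have zero : ∀ d : ℝ, 0 < d → μ (Ioi (1 + d)) = 0 := by
    intro d hd
    have anti : Antitone (fun n : ℕ => Ioi (1 + d / ρ ^ n)) := by
      intro a b hab
      apply Ioi_subset_Ioi
      have : ρ ^ b ≤ ρ ^ a := pow_le_pow_of_le_one hρ.le hρ1.le hab
      gcongr
    have lim := tendsto_measure_iInter_atTop (μ := μ) (s := fun n : ℕ => Ioi (1 + d / ρ ^ n))
      (fun n => measurableSet_Ioi.nullMeasurableSet) anti ⟨0, measure_ne_top _ _⟩
    have hemp : ⋂ n : ℕ, Ioi (1 + d / ρ ^ n) = ∅ := by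
      ext y
      simp only [mem_iInter, mem_Ioi, mem_empty_iff_false, iff_false, not_forall, not_lt]
      have hr : 1 < ρ⁻¹ := (one_lt_inv₀ hρ).2 hρ1
      obtain ⟨n, hn⟩ := pow_unbounded_of_one_lt (y / d) hr
      refine ⟨n, ?_⟩
      rw [div_lt_iff₀ hd, inv_pow] at hn
      have : d / ρ ^ n = (ρ ^ n)⁻¹ * d := by rw [div_eq_inv_mul]
      linarith
    rw [hemp, measure_empty] at lim
    refine le_antisymm (ge_of_tendsto' lim fun n => ?_) (zero_le)
    have := iter d hd n
    exact (ENNReal.toReal_le_toReal (measure_ne_top _ _) (measure_ne_top _ _)).1 this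
  have hU : Ioi (1 : ℝ) = ⋃ n : ℕ, Ioi (1 + 1 / ((n : ℝ) + 1)) := by
    ext y
    simp only [mem_iUnion, mem_Ioi]
    constructor
    · intro hy
      obtain ⟨n, hn⟩ := exists_nat_one_div_lt (sub_pos.2 hy)
      exact ⟨n, by linarith⟩
    · rintro ⟨n, hn⟩
      have : (0 : ℝ) < 1 / ((n : ℝ) + 1) := by positivity
      linarith
  rw [hU, measure_iUnion_null_iff]
  intro n
  exact zero _ (by positivity)

theorem iio_zero [IsProbabilityMeasure μ] (h : Par N ρ (R N ρ)) (hss : IsSelfSimilar N ρ μ) :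
    μ (Iio 0) = 0 := by
  have hm : Measurable (fun y : ℝ => 1 - y) := by fun_prop
  have : IsProbabilityMeasure (μ.map (fun y => 1 - y)) :=
    Measure.isProbabilityMeasure_map hm.aemeasurable
  have e := ioi_one h (ss_reflect h hss)
  rw [Measure.map_apply hm measurableSet_Ioi] at e
  convert e using 2
  ext y; simp

theorem atom_zero [IsProbabilityMeasure μ] (h : Par N ρ (R N ρ)) (hss : IsSelfSimilar N ρ μ) :
    μ {0} = 0 := by
  have h3 := h.three
  have hG := h.Gpos
  have hρ := h.hρ
  have e := ss_apply h.hN hss (A := {0}) (measurableSet_singleton _)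
  have hb : ∀ i ∈ Finset.range N, μ.real (f N ρ i ⁻¹' {0}) ≤ if i = 0 then μ.real {0} else 0 := by
    intro i _
    split_ifs with hi
    · refine measureReal_mono ?_
      subst hi
      intro y hy
      simp only [mem_preimage, f, mem_singleton_iff] at hy ⊢
      push_cast at hy
      have : ρ * y = 0 := by linarith
      exact (mul_eq_zero.1 this).resolve_left hρ.ne'
    · have : μ.real (Iio 0) = 0 := by simp [Measure.real, iio_zero h hss]
      rw [← this]
      refine measureReal_mono ?_
      intro y hy
      simp only [mem_preimage, f, mem_singleton_iff, mem_Iio] at hy ⊢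
      have : 0 < (i : ℝ) := by exact_mod_cast Nat.pos_of_ne_zero hi
      have := mul_pos this hG
      by_contra hc
      push Not at hc
      have := mul_nonneg hρ.le hc
      linarith
  have := Finset.sum_le_sum hb
  have h0 := h.hN
  rw [← e, Finset.sum_ite_eq', if_pos (by simp; omega)] at this
  have hz : μ.real {0} = 0 := by
    have h0 : 0 ≤ μ.real {0} := measureReal_nonneg
    nlinarith
  exact (measureReal_eq_zero_iff).1 hz

theorem iic_zero [IsProbabilityMeasure μ] (h : Par N ρ (R N ρ)) (hss : IsSelfSimilar N ρ μ) :
    μ (Iic 0) = 0 := by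
  have : Iic (0 : ℝ) = Iio 0 ∪ {0} := by ext y; simp [le_iff_lt_or_eq]
  rw [this]
  exact measure_union_null (iio_zero h hss) (atom_zero h hss)

theorem ici_one [IsProbabilityMeasure μ] (h : Par N ρ (R N ρ)) (hss : IsSelfSimilar N ρ μ) :
    μ (Ici 1) = 0 := by
  have hm : Measurable (fun y : ℝ => 1 - y) := by fun_prop
  have : IsProbabilityMeasure (μ.map (fun y => 1 - y)) :=
    Measure.isProbabilityMeasure_map hm.aemeasurable
  have e := iic_zero h (ss_reflect h hss)
  rw [Measure.map_apply hm measurableSet_Iic] at e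
  convert e using 2
  ext y; simp

theorem ioo_one [IsProbabilityMeasure μ] (h : Par N ρ (R N ρ)) (hss : IsSelfSimilar N ρ μ) :
    μ.real (Ioo 0 1) = 1 := by
  have : μ (Ioo 0 1)ᶜ = 0 := by
    refine measure_mono_null (t := Iic 0 ∪ Ici 1) ?_
      (measure_union_null (iic_zero h hss) (ici_one h hss))
    intro y hy
    simp only [mem_compl_iff, mem_Ioo, not_and, not_lt, mem_union, mem_Iic, mem_Ici] at hy ⊢
    by_cases hc : y ≤ 0
    · exact Or.inl hc
    · exact Or.inr (hy (not_le.1 hc))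
  have := (prob_compl_eq_zero_iff (μ := μ) measurableSet_Ioo).1 this
  simp [Measure.real, this]

theorem isCdf [IsProbabilityMeasure μ] (h : Par N ρ (R N ρ)) (hss : IsSelfSimilar N ρ μ) :
    IsCdf N ρ (R N ρ) (fun y => μ.real (Iic y)) := by
  refine ⟨?_, ?_, ?_, ?_⟩
  · intro a b hab
    exact measureReal_mono (Iic_subset_Iic.2 hab)
  · intro y hy
    refine (measureReal_eq_zero_iff).2 (measure_mono_null (Iic_subset_Iic.2 hy) (iic_zero h hss))
  · intro y hy
    refine le_antisymm measureReal_le_one ?_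
    rw [← ioo_one h hss]
    refine measureReal_mono ?_
    intro z hz
    exact hz.2.le.trans hy
  · intro y
    rw [ss_apply h.hN hss measurableSet_Iic]
    refine Finset.sum_congr rfl fun i _ => ?_
    congr 1
    ext z
    simp only [mem_preimage, f, mem_Iic]
    rw [le_div_iff₀ h.hρ, le_sub_iff_add_le, mul_comm]

theorem mass_le [IsProbabilityMeasure μ] (a b : ℝ) (hab : a ≤ b) :
    (μ (Ioo a b)).toReal ≤ μ.real (Iic b) - μ.real (Iic a) := by
  have : μ.real (Ioc a b) = μ.real (Iic b) - μ.real (Iic a) := by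
    rw [← measureReal_sdiff (Iic_subset_Iic.2 hab) measurableSet_Iic]
    congr 1
    ext z
    simp [and_comm]
  rw [← this]
  exact measureReal_mono Ioo_subset_Ioc_self

/-- the interval contains the pieces `i, …, i + l`. -/
theorem mass_ge [IsProbabilityMeasure μ] (h : Par N ρ (R N ρ)) (hss : IsSelfSimilar N ρ μ)
    (i l : ℕ) (hl : i + l < N) (a b : ℝ) (ha : a ≤ i * R N ρ) (hb : (i + l) * R N ρ + ρ ≤ b) :
    (l : ℝ) + 1 ≤ N * (μ (Ioo a b)).toReal := by
  have hG := h.Gpos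
  have hρ := h.hρ
  change _ ≤ N * μ.real (Ioo a b)
  rw [ss_apply h.hN hss measurableSet_Ioo]
  have key : ∀ j ∈ Finset.range N, (if i ≤ j ∧ j ≤ i + l then (1 : ℝ) else 0) ≤
      μ.real (f N ρ j ⁻¹' Ioo a b) := by
    intro j _
    split_ifs with hj
    · rw [← ioo_one h hss]
      refine measureReal_mono ?_
      rintro y ⟨hy0, hy1⟩
      have h1 : (i : ℝ) ≤ j := by exact_mod_cast hj.1
      have h2 : (j : ℝ) ≤ i + l := by exact_mod_cast hj.2
      have h3 := mul_le_mul_of_nonneg_right h1 hG.le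
      have h4 := mul_le_mul_of_nonneg_right h2 hG.le
      have h5 := mul_pos hρ hy0
      have h6 := mul_lt_mul_of_pos_left hy1 hρ
      simp only [mem_preimage, f, mem_Ioo]
      constructor <;> linarith
    · exact measureReal_nonneg
  refine le_trans ?_ (Finset.sum_le_sum key)
  rw [← Finset.sum_filter, Finset.sum_const, nsmul_eq_mul, mul_one]
  have : (Finset.range N).filter (fun j => i ≤ j ∧ j ≤ i + l) = Finset.Icc i (i + l) := by
    ext j; simp; omega
  rw [this, Nat.card_Icc]
  have : i + l + 1 - i = l + 1 := by omega
  rw [this]; push_cast; rfl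

theorem s_facts (hN : 3 ≤ N) (hρ0 : 0 < ρ) (hρ1 : ρ ≤ 1 / (N : ℝ) ^ 2) (s : ℝ)
    (hs : s = -Real.log N / Real.log ρ) : 0 ≤ s ∧ s ≤ 1 / 2 ∧ ρ ^ s = 1 / N := by
  have h3 : (3 : ℝ) ≤ N := by exact_mod_cast hN
  have hlN : 0 < Real.log N := Real.log_pos (by linarith)
  have hl : Real.log ρ ≤ - (2 * Real.log N) := by
    have := Real.log_le_log hρ0 hρ1
    rw [one_div, Real.log_inv, Real.log_pow] at this
    exact_mod_cast this
  have hneg : Real.log ρ < 0 := by linarith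
  refine ⟨?_, ?_, ?_⟩
  · rw [hs]; exact div_nonneg_of_nonpos (by linarith) hneg.le
  · rw [hs, div_le_iff_of_neg hneg]; linarith
  · rw [Real.rpow_def_of_pos hρ0, hs, mul_div_cancel₀ _ hneg.ne, Real.exp_neg,
      Real.exp_log (by linarith), one_div]

/-- Part (i). -/
theorem part_one (hρ0 : 0 < ρ)
    (hρ1 : ρ ≤ 1 / (N : ℝ) ^ 2) (s : ℝ) (hs : s = -Real.log N / Real.log ρ)
    (μ : Measure ℝ) (hprob : IsProbabilityMeasure μ) (hss : IsSelfSimilar N ρ μ)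
    (k : ℕ) (hk1 : 1 ≤ k) (hk2 : k + 2 ≤ N) (x : ℝ)
    (hx : x ∈ Icc ((k : ℝ) * R N ρ) ((k : ℝ) * R N ρ + ρ / 2)) :
      (∀ r : ℝ, (k : ℝ) * R N ρ + ρ - x ≤ r → r ≤ max x (1 - x) →
        (μ (Ioo (x - r) (x + r))).toReal / (2 * r) ^ s ≤
          max (max (ρ ^ s / ((2 : ℝ) ^ s * ((k : ℝ) * R N ρ + ρ - x) ^ s))
            ((1 + 2 * ((min k (N - 1 - k) : ℕ) : ℝ)) * ρ ^ s /
              ((2 : ℝ) ^ s * (((min k (N - 1 - k) : ℕ) : ℝ) * R N ρ +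
                ((k : ℝ) * R N ρ + ρ - x)) ^ s)))
            (1 / ((2 : ℝ) ^ s * (max x (1 - x)) ^ s))) ∧
      (∃ r : ℝ, (k : ℝ) * R N ρ + ρ - x ≤ r ∧ r ≤ max x (1 - x) ∧
        (μ (Ioo (x - r) (x + r))).toReal / (2 * r) ^ s =
          max (max (ρ ^ s / ((2 : ℝ) ^ s * ((k : ℝ) * R N ρ + ρ - x) ^ s))
            ((1 + 2 * ((min k (N - 1 - k) : ℕ) : ℝ)) * ρ ^ s /
              ((2 : ℝ) ^ s * (((min k (N - 1 - k) : ℕ) : ℝ) * R N ρ +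
                ((k : ℝ) * R N ρ + ρ - x)) ^ s)))
            (1 / ((2 : ℝ) ^ s * (max x (1 - x)) ^ s))) := by
  have hN : 3 ≤ N := by omega
  have h := par hN hρ0 hρ1
  obtain ⟨hs0, hs2, hρs⟩ := s_facts hN hρ0 hρ1 s hs
  have hF := isCdf h hss
  have h3 := h.three
  have hG := h.Gpos
  have hG4 := h.G4
  have hg := h.hG
  obtain ⟨hx1, hx2⟩ := hx
  rw [hρs]
  have hge := mass_ge h hss
  generalize R N ρ = G at *
  obtain ⟨t, ht⟩ : ∃ t, t = (k : ℝ) * G + ρ - x := ⟨_, rfl⟩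
  rw [← ht]
  obtain ⟨K, hK⟩ : ∃ K, K = min k (N - 1 - k) := ⟨_, rfl⟩
  rw [← hK]
  obtain ⟨L, hL⟩ : ∃ L, L = max x (1 - x) := ⟨_, rfl⟩
  rw [← hL]
  have ht1 : ρ / 2 ≤ t := by linarith
  have ht2 : t ≤ ρ := by linarith
  have htpos : 0 < t := by linarith
  have hxt : x = k * G + ρ - t := by linarith
  have hKk : K ≤ k := by omega
  have hKN : k + K + 1 ≤ N := by omega
  have hKr : (k : ℝ) + K + 1 ≤ N := by exact_mod_cast hKN
  have hadm : K * G + t ≤ L := by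
    have h1 : 1 - x ≤ L := hL ▸ le_max_right _ _
    have := mul_le_mul_of_nonneg_right (by linarith : (K : ℝ) ≤ N - 1 - k) hG.le
    linarith
  have hKG : 0 ≤ K * G := by positivity
  have hLpos : 0 < L := by linarith
  have h2s : 0 < (2 : ℝ) ^ s := Real.rpow_pos_of_pos (by norm_num) s
  have hts : 0 < t ^ s := Real.rpow_pos_of_pos htpos s
  have hKs : 0 < (K * G + t) ^ s := Real.rpow_pos_of_pos (by linarith) s
  have hLs : 0 < L ^ s := Real.rpow_pos_of_pos hLpos s
  have hNpos : (0 : ℝ) < N := by linarith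
  obtain ⟨D, hD⟩ : ∃ D, D = max (max (1 / (N : ℝ) / (2 ^ s * t ^ s))
    ((1 + 2 * (K : ℝ)) * (1 / N) / (2 ^ s * (K * G + t) ^ s))) (1 / (2 ^ s * L ^ s)) := ⟨_, rfl⟩
  rw [← hD]
  have hD1 : 1 / (N : ℝ) / (2 ^ s * t ^ s) ≤ D :=
    hD ▸ (le_max_left _ _).trans (le_max_left _ _)
  have hD2 : (1 + 2 * (K : ℝ)) * (1 / N) / (2 ^ s * (K * G + t) ^ s) ≤ D :=
    hD ▸ (le_max_right _ _).trans (le_max_left _ _)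
  have hD3 : 1 / (2 ^ s * L ^ s) ≤ D := hD ▸ le_max_right _ _
  have hDpos : 0 ≤ D := le_trans (by positivity) hD3
  have upper : ∀ r : ℝ, t ≤ r → r ≤ L →
      (μ (Ioo (x - r) (x + r))).toReal / (2 * r) ^ s ≤ D := by
    intro r hr1 hr2
    have hr : 0 < r := by linarith
    have hrs : 0 < r ^ s := Real.rpow_pos_of_pos hr s
    have hc := core h hF s hs0 hs2 k hk1 hk2 x t r (N * 2 ^ s * D) hxt ht1 ht2 hr1 (hL ▸ hr2)
      (by positivity)
      (by
        rw [div_div, div_le_iff₀ (by positivity)] at hD1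
        linarith)
      (by
        rw [← hK]
        rw [mul_one_div, div_div, div_le_iff₀ (by positivity)] at hD2
        linarith)
      (by
        rw [← hL]
        rw [div_le_iff₀ (by positivity)] at hD3
        have := mul_le_mul_of_nonneg_left hD3 hNpos.le
        linarith)
    have hm := mass_le (μ := μ) (x - r) (x + r) (by linarith)
    have hm2 := mul_le_mul_of_nonneg_left hm hNpos.le
    have hm3 : (N : ℝ) * (μ (Ioo (x - r) (x + r))).toReal ≤ N * (D * (2 ^ s * r ^ s)) := by
      refine (hm2.trans hc).trans (le_of_eq ?_)
      ring
    rw [Real.mul_rpow (by norm_num) hr.le, div_le_iff₀ (by positivity)]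
    exact le_of_mul_le_mul_left hm3 hNpos
  refine ⟨upper, ?_⟩
  have low : ∀ (r c : ℝ), 0 < r → c ≤ N * (μ (Ioo (x - r) (x + r))).toReal →
      c * (1 / N) / (2 ^ s * r ^ s) ≤ (μ (Ioo (x - r) (x + r))).toReal / (2 * r) ^ s := by
    intro r c hr hc
    rw [Real.mul_rpow (by norm_num) hr.le]
    have hrs : 0 < r ^ s := Real.rpow_pos_of_pos hr s
    gcongr
    rw [mul_one_div, div_le_iff₀ hNpos]
    linarith
  have fin : ∀ r, t ≤ r → r ≤ L → D ≤ (μ (Ioo (x - r) (x + r))).toReal / (2 * r) ^ s →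
      ∃ r : ℝ, t ≤ r ∧ r ≤ L ∧ (μ (Ioo (x - r) (x + r))).toReal / (2 * r) ^ s = D :=
    fun r h1 h2 h3 => ⟨r, h1, h2, le_antisymm (upper r h1 h2) h3⟩
  have c1 := low t 1 htpos (by
    have := hge k 0 (by omega) (x - t) (x + t) (by linarith) (by push_cast; linarith)
    push_cast at this; linarith)
  have c2 := low (K * G + t) (1 + 2 * K) (by linarith) (by
    obtain ⟨p, hp⟩ : ∃ p, k = p + K := ⟨k - K, by omega⟩
    have hpr : (k : ℝ) = p + K := by rw [hp]; push_cast; ring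
    have := hge p (2 * K) (by omega) (x - (K * G + t)) (x + (K * G + t))
      (by rw [hxt, hpr]; linarith) (by push_cast; rw [hxt, hpr]; linarith)
    push_cast at this; linarith)
  have c3 := low L N hLpos (by
    have h1 : x ≤ L := hL ▸ le_max_left _ _
    have h2 : 1 - x ≤ L := hL ▸ le_max_right _ _
    have e : ((N - 1 : ℕ) : ℝ) = N - 1 := by rw [Nat.cast_sub (by omega)]; simp
    have := hge 0 (N - 1) (by omega) (x - L) (x + L) (by push_cast; linarith)
      (by rw [e]; push_cast; linarith)
    rw [e] at this; linarith)
  rw [one_mul] at c1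
  rw [mul_one_div, div_self hNpos.ne'] at c3
  rcases le_total (max (1 / (N : ℝ) / (2 ^ s * t ^ s))
    ((1 + 2 * (K : ℝ)) * (1 / N) / (2 ^ s * (K * G + t) ^ s))) (1 / (2 ^ s * L ^ s)) with hm | hm
  · rw [max_eq_right hm] at hD
    exact fin L (by linarith) le_rfl (hD ▸ c3)
  · rw [max_eq_left hm] at hD
    rcases le_total (1 / (N : ℝ) / (2 ^ s * t ^ s))
      ((1 + 2 * (K : ℝ)) * (1 / N) / (2 ^ s * (K * G + t) ^ s)) with hn | hn
    · rw [max_eq_right hn] at hD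
      exact fin (K * G + t) (by linarith) hadm (hD ▸ c2)
    · rw [max_eq_left hn] at hD
      exact fin t le_rfl (by linarith) (hD ▸ c1)

end

/-- Proposition 2.7: upper bounds for `μ(B(x,r))/(2r)^s` on middle level-1 pieces,
with attainment of the bound for some admissible `r`.  Here `k̂ = min{k, N-1-k}`. -/
theorem upper_bound_middle_pieces (N : ℕ) (hN : 2 ≤ N) (ρ : ℝ) (hρ0 : 0 < ρ)
    (hρ1 : ρ ≤ 1 / (N : ℝ) ^ 2) (s : ℝ) (hs : s = -Real.log N / Real.log ρ)
    (μ : Measure ℝ) (hprob : IsProbabilityMeasure μ) (hss : IsSelfSimilar N ρ μ)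
    (k : ℕ) (hk1 : 1 ≤ k) (hk2 : k ≤ N - 2) :
    (∀ x ∈ Icc ((k : ℝ) * R N ρ) ((k : ℝ) * R N ρ + ρ / 2),
      (∀ r : ℝ, (k : ℝ) * R N ρ + ρ - x ≤ r → r ≤ max x (1 - x) →
        (μ (Ioo (x - r) (x + r))).toReal / (2 * r) ^ s ≤
          max (max (ρ ^ s / ((2 : ℝ) ^ s * ((k : ℝ) * R N ρ + ρ - x) ^ s))
            ((1 + 2 * ((min k (N - 1 - k) : ℕ) : ℝ)) * ρ ^ s /
              ((2 : ℝ) ^ s * (((min k (N - 1 - k) : ℕ) : ℝ) * R N ρ +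
                ((k : ℝ) * R N ρ + ρ - x)) ^ s)))
            (1 / ((2 : ℝ) ^ s * (max x (1 - x)) ^ s))) ∧
      (∃ r : ℝ, (k : ℝ) * R N ρ + ρ - x ≤ r ∧ r ≤ max x (1 - x) ∧
        (μ (Ioo (x - r) (x + r))).toReal / (2 * r) ^ s =
          max (max (ρ ^ s / ((2 : ℝ) ^ s * ((k : ℝ) * R N ρ + ρ - x) ^ s))
            ((1 + 2 * ((min k (N - 1 - k) : ℕ) : ℝ)) * ρ ^ s /
              ((2 : ℝ) ^ s * (((min k (N - 1 - k) : ℕ) : ℝ) * R N ρ +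
                ((k : ℝ) * R N ρ + ρ - x)) ^ s)))
            (1 / ((2 : ℝ) ^ s * (max x (1 - x)) ^ s)))) ∧
    (∀ x ∈ Icc ((k : ℝ) * R N ρ + ρ / 2) ((k : ℝ) * R N ρ + ρ),
      (∀ r : ℝ, x - (k : ℝ) * R N ρ ≤ r → r ≤ max x (1 - x) →
        (μ (Ioo (x - r) (x + r))).toReal / (2 * r) ^ s ≤
          max (max (ρ ^ s / ((2 : ℝ) ^ s * (x - (k : ℝ) * R N ρ) ^ s))
            ((1 + 2 * ((min k (N - 1 - k) : ℕ) : ℝ)) * ρ ^ s /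
              ((2 : ℝ) ^ s * (((min k (N - 1 - k) : ℕ) : ℝ) * R N ρ +
                (x - (k : ℝ) * R N ρ)) ^ s)))
            (1 / ((2 : ℝ) ^ s * (max x (1 - x)) ^ s))) ∧
      (∃ r : ℝ, x - (k : ℝ) * R N ρ ≤ r ∧ r ≤ max x (1 - x) ∧
        (μ (Ioo (x - r) (x + r))).toReal / (2 * r) ^ s =
          max (max (ρ ^ s / ((2 : ℝ) ^ s * (x - (k : ℝ) * R N ρ) ^ s))
            ((1 + 2 * ((min k (N - 1 - k) : ℕ) : ℝ)) * ρ ^ s /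
              ((2 : ℝ) ^ s * (((min k (N - 1 - k) : ℕ) : ℝ) * R N ρ +
                (x - (k : ℝ) * R N ρ)) ^ s)))
            (1 / ((2 : ℝ) ^ s * (max x (1 - x)) ^ s)))) := by
  have hk2' : k + 2 ≤ N := by omega
  refine ⟨fun x hx => part_one hρ0 hρ1 s hs μ hprob hss k hk1 hk2' x hx, fun x hx => ?_⟩
  have h := par (by omega : 3 ≤ N) hρ0 hρ1
  have hm : Measurable (fun y : ℝ => 1 - y) := by fun_prop
  have hprob' : IsProbabilityMeasure (μ.map (fun y => 1 - y)) :=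
    Measure.isProbabilityMeasure_map hm.aemeasurable
  have hg := h.hG
  have e : ((N - 1 - k : ℕ) : ℝ) = N - 1 - k := by
    rw [Nat.cast_sub (by omega), Nat.cast_sub (by omega)]; simp
  have e1 : ((N - 1 - k : ℕ) : ℝ) * R N ρ + ρ - (1 - x) = x - k * R N ρ := by
    rw [e]; linarith
  have e2 : N - 1 - (N - 1 - k) = k := by omega
  have e3 : ∀ r, (μ.map (fun y => 1 - y)) (Ioo (1 - x - r) (1 - x + r)) =
      μ (Ioo (x - r) (x + r)) := by
    intro r
    rw [Measure.map_apply hm measurableSet_Ioo]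
    congr 1
    ext y
    simp only [mem_preimage, mem_Ioo]
    constructor <;> rintro ⟨h1, h2⟩ <;> constructor <;> linarith
  have key := part_one hρ0 hρ1 s hs _ hprob' (ss_reflect h hss) (N - 1 - k) (by omega) (by omega)
    (1 - x) (by
      obtain ⟨h1, h2⟩ := hx
      constructor <;> linarith)
  simp only [e1, e2, e3] at key
  rw [_root_.sub_sub_cancel, max_comm (1 - x) x, min_comm (N - 1 - k) k] at key
  exact key

end HomogeneousCantorDensity
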